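/- Let f_α be the intermittent map with 0 < α < 1 (in which case f_α preserves an absolutely continuous invariant probability measure). Let ψ : [0,∞) → ℝ be monotonically decreasing, let x̃ ∈ S¹, and set φ(x) = ψ(d(x,x̃)) and M_n(x) = max_{0 ≤ k ≤ n−1} φ(f_α^k(x)). Then for every ε > 0 and Lebesgue-almost every x ∈ S¹, ψ((log n)^{4+ε}/n) ≤ M_n(x) ≤ ψ(1/(n·(log n)^{2+ε})) for all sufficiently large n. -/

import Mathlib

open MeasureTheory Filter Set Real

noncomputable section

/-- The Liverani–Saussol–Vaienti intermittent map on `S¹ = [0,1)`: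
`f_α(x) = x(1 + 2^α x^α)` for `x < 1/2` and `f_α(x) = 2x − 1` for `x ≥ 1/2`. -/
def lsv (a : ℝ) (x : ℝ) : ℝ :=
  if x < 1 / 2 then x * (1 + 2 ^ a * x ^ a) else 2 * x - 1

/-- The circle distance on `S¹ = [0,1)`: `d(x,y) = min(|x−y|, 1−|x−y|)`. -/
def circDist (x y : ℝ) : ℝ := min |x - y| (1 - |x - y|)

/-- Maximum process `M_n(x) = max_{0 ≤ k ≤ n-1} φ(f^k x)`. -/
def maxProc {X : Type*} (f : X → X) (φ : X → ℝ) (n : ℕ) (x : X) : ℝ :=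
  ⨆ k : Fin n, φ (f^[k] x)

open scoped ENNReal

/-! ### Measures with density in the Liverani–Saussol–Vaienti cone -/

def LsvDens (g : ℝ → ℝ≥0∞) (μ : Measure ℝ) : Prop :=
  ∀ s, MeasurableSet s → μ s = ∫⁻ x in s ∩ Ioo (0:ℝ) 1, g x

def LsvCone (a : ℝ) (μ : Measure ℝ) : Prop :=
  ∃ g : ℝ → ℝ≥0∞, AntitoneOn g (Ioo (0:ℝ) 1) ∧
    MonotoneOn (fun x => ENNReal.ofReal (x ^ (1 + a)) * g x) (Ioo (0:ℝ) 1) ∧ LsvDens g μ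

def LsvGood (a : ℝ) (μ : Measure ℝ) : Prop :=
  LsvCone a μ ∧ ∀ s, MeasurableSet s →
    μ s ≤ 4 * μ univ * volume (s ∩ Ioo (0:ℝ) 1) ∧
    μ univ * volume (s ∩ Ioo (0:ℝ) 1) ≤ 4 * μ s

/-- Density of the image of a measure by a monotone branch. -/
lemma lsvDens_branch {g : ℝ → ℝ≥0∞} {μ : Measure ℝ} (hμ : LsvDens g μ)
    {f φ' l : ℝ → ℝ} {S : Set ℝ} (hf : Measurable f) (hS : MeasurableSet S)
    (hSI : S ⊆ Ioo (0:ℝ) 1)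
    (hbij : BijOn f S (Ioo (0:ℝ) 1)) (hder : ∀ y ∈ S, HasDerivWithinAt f (φ' y) S y)
    (hpos : ∀ y ∈ S, 0 < φ' y) (hl : ∀ y ∈ S, l (f y) = y) :
    LsvDens (fun x => g (l x) / ENNReal.ofReal (φ' (l x))) (Measure.map f (μ.restrict S)) := by
  intro s hs
  rw [Measure.map_apply hf hs, Measure.restrict_apply (hf hs), hμ _ ((hf hs).inter hS)]
  have h1 : f ⁻¹' s ∩ S ∩ Ioo 0 1 = f ⁻¹' s ∩ S := by
    apply inter_eq_left.mpr
    exact fun x hx => hSI hx.2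
  have h2 : s ∩ Ioo 0 1 = f '' (f ⁻¹' s ∩ S) := by
    rw [inter_comm, inter_comm (f ⁻¹' s), image_inter_preimage, hbij.image_eq]
  rw [h1, h2, lintegral_image_eq_lintegral_abs_deriv_mul ((hf hs).inter hS)
    (fun x hx => (hder x hx.2).mono inter_subset_right)
    (hbij.injOn.mono inter_subset_right)]
  apply setLIntegral_congr_fun ((hf hs).inter hS)
  intro x hx
  simp only
  rw [hl x hx.2, abs_of_pos (hpos x hx.2), ENNReal.mul_div_cancel]
  · simpa using hpos x hx.2
  · exact ENNReal.ofReal_ne_top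

lemma lsvCone_branch {a : ℝ} {g : ℝ → ℝ≥0∞} (hg : AntitoneOn g (Ioo (0:ℝ) 1))
    (hg' : MonotoneOn (fun x => ENNReal.ofReal (x ^ (1 + a)) * g x) (Ioo (0:ℝ) 1))
    {f φ' l : ℝ → ℝ} {S : Set ℝ} 
    (hSI : S ⊆ Ioo (0:ℝ) 1)
    (hbij : BijOn f S (Ioo (0:ℝ) 1)) (hmono : StrictMonoOn f S)
    (hpos : ∀ y ∈ S, 0 < φ' y) (hl : ∀ y ∈ S, l (f y) = y)
    (hφ : MonotoneOn φ' S) (hw : MonotoneOn (fun y => (f y / y) ^ (1 + a) / φ' y) S) :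
    AntitoneOn (fun x => g (l x) / ENNReal.ofReal (φ' (l x))) (Ioo (0:ℝ) 1) ∧
    MonotoneOn (fun x => ENNReal.ofReal (x ^ (1 + a)) *
      (g (l x) / ENNReal.ofReal (φ' (l x)))) (Ioo (0:ℝ) 1) := by
  constructor
  · intro x hx x' hx' hxx
    obtain ⟨y, hy, rfl⟩ := hbij.surjOn hx
    obtain ⟨y', hy', rfl⟩ := hbij.surjOn hx'
    have hyy : y ≤ y' := (hmono.le_iff_le hy hy').1 hxx
    simp only [hl y hy, hl y' hy']
    exact ENNReal.div_le_div (hg (hSI hy) (hSI hy') hyy)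
      (ENNReal.ofReal_le_ofReal (hφ hy hy' hyy))
  · have key : ∀ y ∈ S, ENNReal.ofReal (f y ^ (1 + a)) * (g y / ENNReal.ofReal (φ' y)) =
        ENNReal.ofReal ((f y / y) ^ (1 + a) / φ' y) * (ENNReal.ofReal (y ^ (1 + a)) * g y) := by
      intro y hy
      have hy0 : 0 < y := (hSI hy).1
      have hf0 : 0 < f y := (hbij.mapsTo hy).1
      rw [← mul_assoc, ← ENNReal.ofReal_mul (by have := hpos y hy; positivity),
        ENNReal.div_eq_inv_mul, ← ENNReal.ofReal_inv_of_pos (hpos y hy), ← mul_assoc,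
        ← ENNReal.ofReal_mul (by positivity)]
      congr 2
      rw [div_rpow hf0.le hy0.le]
      have := (rpow_pos_of_pos hy0 (1 + a)).ne'
      field_simp
    intro x hx x' hx' hxx
    obtain ⟨y, hy, rfl⟩ := hbij.surjOn hx
    obtain ⟨y', hy', rfl⟩ := hbij.surjOn hx'
    have hyy : y ≤ y' := (hmono.le_iff_le hy hy').1 hxx
    simp only [hl y hy, hl y' hy']
    rw [key y hy, key y' hy']
    exact mul_le_mul' (ENNReal.ofReal_le_ofReal (hw hy hy' hyy)) (hg' (hSI hy) (hSI hy') hyy)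

/-! ### The two branches -/

lemma lsv_left {a x : ℝ} (hx : x < 1 / 2) : lsv a x = x * (1 + 2 ^ a * x ^ a) := by
  simp only [lsv, if_pos hx]

lemma lsv_right {a x : ℝ} (hx : 1 / 2 ≤ x) : lsv a x = 2 * x - 1 := by
  simp only [lsv, if_neg (not_lt.2 hx)]

lemma lsv_measurable (a : ℝ) : Measurable (lsv a) := by
  unfold lsv
  refine Measurable.ite measurableSet_Iio ?_ ?_
  · fun_prop
  · fun_prop

lemma lsv_t_lt {a x : ℝ} (ha0 : 0 < a) (hx0 : 0 ≤ x) (hx : x < 1 / 2) :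
    2 ^ a * x ^ a < 1 := by
  rw [← mul_rpow (by norm_num) hx0]
  exact rpow_lt_one (by positivity) (by linarith) ha0

lemma lsv_mem_Ico {a x : ℝ} (ha0 : 0 < a) (hx : x ∈ Ico (0:ℝ) 1) : lsv a x ∈ Ico (0:ℝ) 1 := by
  obtain ⟨h0, h1⟩ := hx
  by_cases h : x < 1 / 2
  · rw [lsv_left h]
    have := lsv_t_lt ha0 h0 h
    have h2 : 0 ≤ (2:ℝ) ^ a * x ^ a := by positivity
    constructor
    · positivity
    · nlinarith
  · rw [lsv_right (not_lt.1 h)]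
    constructor <;> linarith

lemma lsv_left_ge {a x : ℝ} (hx0 : 0 ≤ x) (hx : x < 1 / 2) : x ≤ lsv a x := by
  rw [lsv_left hx]
  have h2 : 0 ≤ (2:ℝ) ^ a * x ^ a := by positivity
  nlinarith

lemma lsv_left_expand {a x y : ℝ} (ha0 : 0 < a) (hx : x ∈ Ioo (0:ℝ) (1 / 2))
    (hy : y ∈ Ioo (0:ℝ) (1 / 2)) (hxy : x ≤ y) : y - x ≤ lsv a y - lsv a x := by
  rw [lsv_left hx.2, lsv_left hy.2]
  have h1 : x ^ a ≤ y ^ a := rpow_le_rpow hx.1.le hxy ha0.le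
  have h2 : x * x ^ a ≤ y * y ^ a := mul_le_mul hxy h1 (by have := hx.1; positivity) hy.1.le
  have h3 : (2:ℝ) ^ a * (x * x ^ a) ≤ 2 ^ a * (y * y ^ a) := by gcongr
  nlinarith

lemma lsv_left_strictMono {a : ℝ} (ha0 : 0 < a) : StrictMonoOn (lsv a) (Ioo (0:ℝ) (1 / 2)) := by
  intro x hx y hy hxy
  have := lsv_left_expand ha0 hx hy hxy.le
  linarith

lemma lsv_left_bijOn {a : ℝ} (ha0 : 0 < a) :
    BijOn (lsv a) (Ioo (0:ℝ) (1 / 2)) (Ioo (0:ℝ) 1) := by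
  refine ⟨?_, (lsv_left_strictMono ha0).injOn, ?_⟩
  · intro x hx
    refine ⟨?_, (lsv_mem_Ico ha0 ⟨hx.1.le, by linarith [hx.2]⟩).2⟩
    exact lt_of_lt_of_le hx.1 (lsv_left_ge hx.1.le hx.2)
  · intro y hy
    have hc : ContinuousOn (fun x : ℝ => x * (1 + 2 ^ a * x ^ a)) (Icc 0 (1 / 2)) := by
      apply Continuous.continuousOn
      have : Continuous fun x : ℝ => x ^ a := continuous_id.rpow_const (fun _ => Or.inr ha0.le)
      fun_prop
    have := intermediate_value_Ioo (by norm_num : (0:ℝ) ≤ 1 / 2) hc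
    have h2 : (2:ℝ) ^ a * (1 / 2) ^ a = 1 := by
      rw [← mul_rpow (by norm_num) (by norm_num)]; norm_num
    simp only [h2] at this
    have hy' : y ∈ Ioo (0 * (1 + (2:ℝ) ^ a * 0 ^ a)) (1 / 2 * (1 + 1)) := by
      constructor
      · simpa using hy.1
      · norm_num; exact hy.2
    obtain ⟨x, hx, hxy⟩ := this hy'
    refine ⟨x, hx, ?_⟩
    rw [lsv_left hx.2]; exact hxy

lemma lsv_left_deriv {a : ℝ} (y : ℝ) (hy : y ∈ Ioo (0:ℝ) (1 / 2)) :
    HasDerivWithinAt (lsv a) (1 + (1 + a) * (2 ^ a * y ^ a)) (Ioo (0:ℝ) (1 / 2)) y := by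
  have h1 : HasDerivAt (fun x : ℝ => x * (1 + 2 ^ a * x ^ a))
      (1 * (1 + 2 ^ a * y ^ a) + y * (2 ^ a * (a * y ^ (a - 1)))) y := by
    have := (Real.hasDerivAt_rpow_const (x := y) (p := a) (Or.inl hy.1.ne'))
    exact (hasDerivAt_id y).mul ((this.const_mul (2 ^ a)).const_add 1)
  have h2 : 1 * (1 + 2 ^ a * y ^ a) + y * (2 ^ a * (a * y ^ (a - 1))) =
      1 + (1 + a) * (2 ^ a * y ^ a) := by
    have : y ^ a = y * y ^ (a - 1) := by
      rw [rpow_sub_one hy.1.ne']; field_simp [hy.1.ne']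
    rw [this]; ring
  rw [h2] at h1
  exact h1.hasDerivWithinAt.congr (fun x hx => lsv_left hx.2) (lsv_left hy.2)

lemma lsv_weight_mono {a t t' : ℝ} (ha0 : 0 < a) (ht : 0 ≤ t) (htt : t ≤ t') :
    (1 + t) ^ (1 + a) / (1 + (1 + a) * t) ≤ (1 + t') ^ (1 + a) / (1 + (1 + a) * t') := by
  have h1 : 0 < 1 + t := by linarith
  have hat : 0 ≤ a * t := by positivity
  have hat' : 0 ≤ a * t' := by have := ht.trans htt; positivity
  have hu : 0 ≤ (t' - t) / (1 + t) := div_nonneg (by linarith) h1.le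
  have h2 : 1 + t' = (1 + t) * (1 + (t' - t) / (1 + t)) := by field_simp; ring
  have hb := one_add_mul_self_le_rpow_one_add (s := (t' - t) / (1 + t)) (by linarith)
    (p := 1 + a) (by linarith)
  have h3 : (1 + (1 + a) * t') ≤ (1 + (1 + a) * t) * (1 + (1 + a) * ((t' - t) / (1 + t))) := by
    have e : (t' - t) = ((t' - t) / (1 + t)) * (1 + t) := by field_simp
    set u := (t' - t) / (1 + t)
    have : t' = t + u * (1 + t) := by linarith
    rw [this]
    nlinarith [mul_nonneg hu (mul_nonneg ha0.le ht), mul_nonneg (mul_nonneg hu ha0.le) (mul_nonneg ha0.le ht)]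
  rw [div_le_div_iff₀ (by nlinarith) (by nlinarith)]
  rw [h2, mul_rpow h1.le (by linarith)]
  have hp : 0 < (1 + t) ^ (1 + a) := by positivity
  calc (1 + t) ^ (1 + a) * (1 + (1 + a) * t')
      ≤ (1 + t) ^ (1 + a) * ((1 + (1 + a) * t) * (1 + (1 + a) * ((t' - t) / (1 + t)))) := by gcongr
    _ ≤ (1 + t) ^ (1 + a) * ((1 + (1 + a) * t) * (1 + (t' - t) / (1 + t)) ^ (1 + a)) := by
        gcongr
    _ = _ := by ring

lemma lsvCone_left {a : ℝ} (ha0 : 0 < a) {μ : Measure ℝ} (h : LsvCone a μ) :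
    LsvCone a (Measure.map (lsv a) (μ.restrict (Ioo 0 (1 / 2)))) := by
  obtain ⟨g, hg, hg', hd⟩ := h
  have hpos : ∀ y ∈ Ioo (0:ℝ) (1 / 2), 0 < 1 + (1 + a) * ((2:ℝ) ^ a * y ^ a) := by
    intro y hy
    have := hy.1
    positivity
  have hSI : Ioo (0:ℝ) (1 / 2) ⊆ Ioo 0 1 := Ioo_subset_Ioo le_rfl (by norm_num)
  have hbij := lsv_left_bijOn ha0
  have hl : ∀ y ∈ Ioo (0:ℝ) (1 / 2), Function.invFunOn (lsv a) (Ioo (0:ℝ) (1 / 2)) (lsv a y) = y :=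
    fun y hy => hbij.injOn.leftInvOn_invFunOn hy
  have ht : ∀ x ∈ Ioo (0:ℝ) (1 / 2), ∀ y ∈ Ioo (0:ℝ) (1 / 2), x ≤ y →
      (2:ℝ) ^ a * x ^ a ≤ (2:ℝ) ^ a * y ^ a := by
    intro x hx y hy hxy
    have := rpow_le_rpow hx.1.le hxy ha0.le
    gcongr
  have hC := lsvCone_branch hg hg' (φ' := fun y => 1 + (1 + a) * ((2:ℝ) ^ a * y ^ a))
    (l := Function.invFunOn (lsv a) (Ioo (0:ℝ) (1 / 2))) hSI hbij (lsv_left_strictMono ha0)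
    hpos hl (by
      intro x hx y hy hxy
      have := ht x hx y hy hxy
      simp only
      gcongr) (by
      intro x hx y hy hxy
      simp only
      rw [lsv_left hx.2, lsv_left hy.2, mul_div_cancel_left₀ _ hx.1.ne',
        mul_div_cancel_left₀ _ hy.1.ne']
      have hx0 := hx.1
      exact lsv_weight_mono ha0 (by positivity) (ht x hx y hy hxy))
  exact ⟨_, hC.1, hC.2, lsvDens_branch hd
    (φ' := fun y => 1 + (1 + a) * ((2:ℝ) ^ a * y ^ a))
    (l := Function.invFunOn (lsv a) (Ioo (0:ℝ) (1 / 2))) (lsv_measurable a) measurableSet_Ioo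
    hSI hbij lsv_left_deriv hpos hl⟩

lemma lsvGood_of_ratio {a : ℝ} {μ : Measure ℝ} (h : LsvCone a μ) {g : ℝ → ℝ≥0∞}
    (hd : LsvDens g μ)
    (hr : ∀ x ∈ Ioo (0:ℝ) 1, ∀ y ∈ Ioo (0:ℝ) 1, g x ≤ 4 * g y) : LsvGood a μ := by
  refine ⟨h, fun s hs => ?_⟩
  have hu : μ univ = ∫⁻ x in Ioo (0:ℝ) 1, g x := by
    rw [hd _ MeasurableSet.univ, univ_inter]
  have hm : MeasurableSet (s ∩ Ioo (0:ℝ) 1) := hs.inter measurableSet_Ioo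
  have e1 : ∀ x ∈ Ioo (0:ℝ) 1, g x ≤ 4 * μ univ := by
    intro x hx
    rw [hu, ← lintegral_const_mul' _ _ (by norm_num)]
    calc g x = ∫⁻ y in Ioo (0:ℝ) 1, g x := by simp
      _ ≤ _ := setLIntegral_mono' measurableSet_Ioo (fun y hy => hr x hx y hy)
  have e2 : ∀ x ∈ Ioo (0:ℝ) 1, μ univ ≤ 4 * g x := by
    intro x hx
    rw [hu]
    calc ∫⁻ y in Ioo (0:ℝ) 1, g y ≤ ∫⁻ y in Ioo (0:ℝ) 1, 4 * g x :=
          setLIntegral_mono' measurableSet_Ioo (fun y hy => hr y hy x hx)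
      _ = _ := by simp
  constructor
  · rw [hd s hs]
    calc ∫⁻ x in s ∩ Ioo 0 1, g x ≤ ∫⁻ x in s ∩ Ioo 0 1, 4 * μ univ :=
          setLIntegral_mono' hm (fun y hy => e1 y hy.2)
      _ = _ := by simp
  · rw [hd s hs, ← lintegral_const_mul' _ _ (by norm_num)]
    calc μ univ * volume (s ∩ Ioo 0 1) = ∫⁻ x in s ∩ Ioo 0 1, μ univ := by simp
      _ ≤ _ := setLIntegral_mono' hm (fun y hy => e2 y hy.2)

lemma lsvGood_right {a : ℝ} (ha0 : 0 < a) (ha1 : a < 1) {μ : Measure ℝ} (h : LsvCone a μ) :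
    LsvGood a (Measure.map (lsv a) (μ.restrict (Ioo (1 / 2) 1))) := by
  obtain ⟨g, hg, hg', hd⟩ := h
  have hSI : Ioo (1 / 2 : ℝ) 1 ⊆ Ioo 0 1 := Ioo_subset_Ioo (by norm_num) le_rfl
  have hmono : StrictMonoOn (lsv a) (Ioo (1 / 2 : ℝ) 1) := by
    intro x hx y hy hxy
    rw [lsv_right hx.1.le, lsv_right hy.1.le]; linarith
  have hl : ∀ y ∈ Ioo (1 / 2 : ℝ) 1, (fun x : ℝ => (x + 1) / 2) (lsv a y) = y := by
    intro y hy
    simp only [lsv_right hy.1.le]; ring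
  have hbij : BijOn (lsv a) (Ioo (1 / 2 : ℝ) 1) (Ioo 0 1) := by
    refine ⟨?_, hmono.injOn, ?_⟩
    · intro x hx
      rw [lsv_right hx.1.le]
      constructor <;> linarith [hx.1, hx.2]
    · intro y hy
      have hm : (y + 1) / 2 ∈ Ioo (1 / 2 : ℝ) 1 := by constructor <;> linarith [hy.1, hy.2]
      exact ⟨(y + 1) / 2, hm, by rw [lsv_right hm.1.le]; ring⟩
  have hder : ∀ y ∈ Ioo (1 / 2 : ℝ) 1, HasDerivWithinAt (lsv a) ((fun _ => (2:ℝ)) y)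
      (Ioo (1 / 2 : ℝ) 1) y := by
    intro y hy
    have : HasDerivAt (fun x : ℝ => 2 * x - 1) 2 y := by
      simpa using ((hasDerivAt_id y).const_mul 2).sub_const 1
    exact this.hasDerivWithinAt.congr (fun x hx => lsv_right hx.1.le) (lsv_right hy.1.le)
  have hpos : ∀ y ∈ Ioo (1 / 2 : ℝ) 1, 0 < (fun _ => (2:ℝ)) y := by intros; norm_num
  have hD := lsvDens_branch hd (φ' := fun _ => (2:ℝ)) (l := fun x : ℝ => (x + 1) / 2)
    (lsv_measurable a) measurableSet_Ioo hSI hbij hder hpos hl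
  have hC := lsvCone_branch hg hg' (φ' := fun _ => (2:ℝ)) (l := fun x : ℝ => (x + 1) / 2)
    hSI hbij hmono hpos hl (fun _ _ _ _ _ => le_rfl) (by
    intro x hx y hy hxy
    simp only
    rw [lsv_right hx.1.le, lsv_right hy.1.le]
    have hx0 := (hSI hx).1
    have hy0 := (hSI hy).1
    have : (2 * x - 1) / x ≤ (2 * y - 1) / y := by
      rw [div_le_div_iff₀ hx0 hy0]; nlinarith
    have h0 : 0 ≤ (2 * x - 1) / x := div_nonneg (by linarith [hx.1]) hx0.le
    have := rpow_le_rpow h0 this (by linarith : 0 ≤ 1 + a)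
    linarith)
  refine lsvGood_of_ratio ⟨_, hC.1, hC.2, hD⟩ hD ?_
  intro x hx y hy
  rcases le_total y x with hxy | hxy
  · refine (hC.1 hy hx hxy).trans ?_
    exact le_mul_of_one_le_left (zero_le) (by norm_num)
  · rw [← mul_div_assoc]
    refine ENNReal.div_le_div_right ?_ _
    have hu : (x + 1) / 2 ∈ Ioo (0:ℝ) 1 := by constructor <;> linarith [hx.1, hx.2]
    have hv : (y + 1) / 2 ∈ Ioo (0:ℝ) 1 := by constructor <;> linarith [hy.1, hy.2]
    have h1 := hg' hu hv (by linarith)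
    simp only at h1
    have h2 : ENNReal.ofReal (((y + 1) / 2) ^ (1 + a)) ≤ 1 := by
      rw [ENNReal.ofReal_le_one]
      exact rpow_le_one hv.1.le hv.2.le (by linarith)
    have h3 : 1 ≤ 4 * ENNReal.ofReal (((x + 1) / 2) ^ (1 + a)) := by
      have h4 : (1 / 4 : ℝ) ≤ ((x + 1) / 2) ^ (1 + a) := by
        calc (1 / 4 : ℝ) = (1 / 2 : ℝ) ^ (2:ℝ) := by norm_num
          _ ≤ (1 / 2 : ℝ) ^ (1 + a) :=
            rpow_le_rpow_of_exponent_ge (by norm_num) (by norm_num) (by linarith)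
          _ ≤ _ := rpow_le_rpow (by norm_num) (by linarith [hx.1]) (by linarith)
      have : (4 : ℝ≥0∞) = ENNReal.ofReal 4 := by norm_num
      rw [this, ← ENNReal.ofReal_mul (by norm_num), ← ENNReal.ofReal_one]
      exact ENNReal.ofReal_le_ofReal (by linarith)
    calc g ((x + 1) / 2) ≤ 4 * ENNReal.ofReal (((x + 1) / 2) ^ (1 + a)) * g ((x + 1) / 2) :=
          le_mul_of_one_le_left (zero_le) h3
      _ = 4 * (ENNReal.ofReal (((x + 1) / 2) ^ (1 + a)) * g ((x + 1) / 2)) := by ring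
      _ ≤ 4 * (ENNReal.ofReal (((y + 1) / 2) ^ (1 + a)) * g ((y + 1) / 2)) := by gcongr
      _ ≤ 4 * (1 * g ((y + 1) / 2)) := by gcongr
      _ = _ := by rw [one_mul]

/-! ### Stability and consequences -/

lemma lsvCone_sum {a : ℝ} {ι : Type*} [Countable ι] {μ : ι → Measure ℝ}
    (h : ∀ i, LsvCone a (μ i)) : LsvCone a (Measure.sum μ) := by
  choose g hg hg' hd using h
  refine ⟨fun x => ∑' i, g i x, ?_, ?_, ?_⟩
  · intro x hx y hy hxy
    exact ENNReal.tsum_le_tsum fun i => hg i hx hy hxy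
  · intro x hx y hy hxy
    simp only [← ENNReal.tsum_mul_left]
    exact ENNReal.tsum_le_tsum fun i => hg' i hx hy hxy
  · intro s hs
    rw [Measure.sum_apply _ hs, lintegral_tsum]
    · exact tsum_congr fun i => hd i s hs
    · intro i
      exact aemeasurable_restrict_of_antitoneOn (hs.inter measurableSet_Ioo)
        ((hg i).mono inter_subset_right)

lemma lsvGood_sum {a : ℝ} {ι : Type*} [Countable ι] {μ : ι → Measure ℝ}
    (h : ∀ i, LsvGood a (μ i)) : LsvGood a (Measure.sum μ) := by
  refine ⟨lsvCone_sum fun i => (h i).1, fun s hs => ?_⟩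
  rw [Measure.sum_apply _ hs, Measure.sum_apply _ MeasurableSet.univ]
  simp only [← ENNReal.tsum_mul_left, ← ENNReal.tsum_mul_right]
  exact ⟨ENNReal.tsum_le_tsum fun i => ((h i).2 s hs).1,
    ENNReal.tsum_le_tsum fun i => ((h i).2 s hs).2⟩

lemma lsvCone_null {a : ℝ} {μ : Measure ℝ} (h : LsvCone a μ) {s : Set ℝ}
    (hs : MeasurableSet s) (h0 : volume (s ∩ Ioo (0:ℝ) 1) = 0) : μ s = 0 := by
  obtain ⟨g, -, -, hd⟩ := h
  rw [hd s hs, setLIntegral_measure_zero _ _ h0]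

lemma lsvCone_restrict_eq {a : ℝ} {μ : Measure ℝ} (h : LsvCone a μ) {s : Set ℝ}
    (hs : MeasurableSet s) (h0 : volume (sᶜ ∩ Ioo (0:ℝ) 1) = 0) : μ.restrict s = μ := by
  rw [Measure.restrict_eq_self_of_ae_mem]
  exact lsvCone_null h hs.compl h0

lemma lsvCone_bound {a δ : ℝ} {μ : Measure ℝ} (h : LsvCone a μ) {s : Set ℝ}
    (hs : MeasurableSet s) (hδ : 0 < δ) (hsδ : s ⊆ Ici δ) :
    μ s ≤ ENNReal.ofReal (1 / δ) * μ univ * volume s := by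
  obtain ⟨g, hg, -, hd⟩ := h
  have hu : μ univ = ∫⁻ x in Ioo (0:ℝ) 1, g x := by
    rw [hd _ MeasurableSet.univ, univ_inter]
  have e1 : ∀ x ∈ Ioo (0:ℝ) 1, δ ≤ x → g x ≤ ENNReal.ofReal (1 / δ) * μ univ := by
    intro x hx hδx
    have : ENNReal.ofReal δ * g x ≤ μ univ := by
      rw [hu]
      calc ENNReal.ofReal δ * g x ≤ ENNReal.ofReal x * g x := by gcongr
        _ = ∫⁻ y in Ioo (0:ℝ) x, g x := by simp [mul_comm]
        _ ≤ ∫⁻ y in Ioo (0:ℝ) x, g y := setLIntegral_mono' measurableSet_Ioo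
            (fun y hy => hg ⟨hy.1, hy.2.trans hx.2⟩ hx hy.2.le)
        _ ≤ _ := lintegral_mono_set (Ioo_subset_Ioo le_rfl hx.2.le)
    calc g x = ENNReal.ofReal (1 / δ) * (ENNReal.ofReal δ * g x) := by
          rw [← mul_assoc, ← ENNReal.ofReal_mul (by positivity), one_div_mul_cancel hδ.ne']
          simp
      _ ≤ _ := by gcongr
  rw [hd s hs]
  calc ∫⁻ x in s ∩ Ioo 0 1, g x ≤ ∫⁻ x in s ∩ Ioo 0 1, ENNReal.ofReal (1 / δ) * μ univ :=
        setLIntegral_mono' (hs.inter measurableSet_Ioo) (fun y hy => e1 y hy.2 (hsδ hy.1))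
    _ = ENNReal.ofReal (1 / δ) * μ univ * volume (s ∩ Ioo 0 1) := by simp
    _ ≤ _ := by gcongr; exact inter_subset_left

lemma lsvGood_leb {a : ℝ} (ha0 : 0 < a) : LsvGood a (volume.restrict (Ioo (0:ℝ) 1)) := by
  have hd : LsvDens (fun _ => 1) (volume.restrict (Ioo (0:ℝ) 1)) := by
    intro s hs
    simp [Measure.restrict_apply hs]
  refine lsvGood_of_ratio ⟨fun _ => 1, antitoneOn_const, ?_, hd⟩ hd ?_
  · intro x hx y hy hxy
    simp only [mul_one]
    exact ENNReal.ofReal_le_ofReal (rpow_le_rpow hx.1.le hxy (by linarith))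
  · intro x _ y _; norm_num

lemma lsvCone_map {a : ℝ} (ha0 : 0 < a) (ha1 : a < 1) {μ : Measure ℝ} (h : LsvCone a μ) :
    LsvCone a (Measure.map (lsv a) μ) := by
  have h1 : μ.restrict (⋃ b : Bool, if b then Ioo (0:ℝ) (1 / 2) else Ioo (1 / 2 : ℝ) 1) = μ := by
    apply lsvCone_restrict_eq h
    · exact MeasurableSet.iUnion fun b => by cases b <;> simp
    · apply measure_mono_null (t := {(1 / 2 : ℝ)}) _ (by simp)
      intro x hx
      simp only [compl_iUnion, mem_inter_iff, mem_iInter, Bool.forall_bool, mem_compl_iff,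
        if_true, Bool.false_eq_true, if_false, mem_Ioo, not_and, not_lt] at hx
      have h2 := hx.1.2 hx.2.1
      rcases h2.lt_or_eq with h3 | h3
      · linarith [hx.1.1 h3, hx.2.2]
      · exact h3.symm
  rw [← h1, Measure.restrict_iUnion, Measure.map_sum (lsv_measurable a).aemeasurable]
  · apply lsvCone_sum
    rintro (_ | _)
    · exact (lsvGood_right ha0 ha1 h).1
    · exact lsvCone_left ha0 h
  · intro i j hij
    apply Set.disjoint_left.2
    cases i <;> cases j <;> simp at hij ⊢ <;> intros <;> linarith
  · rintro (_ | _) <;> simp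

lemma lsvCone_iter {a : ℝ} (ha0 : 0 < a) (ha1 : a < 1) (k : ℕ) :
    LsvCone a (Measure.map (lsv a)^[k] (volume.restrict (Ioo (0:ℝ) 1))) := by
  induction k with
  | zero => simpa using (lsvGood_leb ha0).1
  | succ k ih =>
    rw [Function.iterate_succ', ← Measure.map_map (lsv_measurable a)
      ((lsv_measurable a).iterate k)]
    exact lsvCone_map ha0 ha1 ih
/-! ### Upper bound -/

lemma lsv_iter_mem_Ico {a x : ℝ} (ha0 : 0 < a) (hx : x ∈ Ico (0:ℝ) 1) (k : ℕ) :
    (lsv a)^[k] x ∈ Ico (0:ℝ) 1 := by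
  induction k with
  | zero => simpa using hx
  | succ k ih => rw [Function.iterate_succ_apply']; exact lsv_mem_Ico ha0 ih

lemma lsv_hit_bound {a δ : ℝ} (ha0 : 0 < a) (ha1 : a < 1) {D : Set ℝ} (hD : MeasurableSet D)
    (hδ : 0 < δ) (hDδ : D ⊆ Ici δ) (n : ℕ) :
    (volume.restrict (Ioo (0:ℝ) 1)) {x | ∃ k < n, (lsv a)^[k] x ∈ D} ≤
      n * (ENNReal.ofReal (1 / δ) * volume D) := by
  have h1 : {x | ∃ k < n, (lsv a)^[k] x ∈ D} ⊆ ⋃ k ∈ Finset.range n, (lsv a)^[k] ⁻¹' D := by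
    rintro x ⟨k, hk, hx⟩
    simp only [mem_iUnion, Finset.mem_range]
    exact ⟨k, hk, hx⟩
  refine (measure_mono h1).trans ((measure_biUnion_finset_le _ _).trans ?_)
  have h2 : ∀ k ∈ Finset.range n, (volume.restrict (Ioo (0:ℝ) 1)) ((lsv a)^[k] ⁻¹' D) ≤
      ENNReal.ofReal (1 / δ) * volume D := by
    intro k _
    rw [← Measure.map_apply ((lsv_measurable a).iterate k) hD]
    refine (lsvCone_bound (lsvCone_iter ha0 ha1 k) hD hδ hDδ).trans ?_
    rw [Measure.map_apply ((lsv_measurable a).iterate k) MeasurableSet.univ]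
    simp
  refine (Finset.sum_le_sum h2).trans ?_
  simp

lemma lsv_near_bound {a xt : ℝ} (ha0 : 0 < a) (ha1 : a < 1) (hxt : xt ∈ Ico (0:ℝ) 1) :
    ∃ C : ℝ≥0∞, C ≠ ⊤ ∧ ∃ s0 : ℝ, 0 < s0 ∧ ∀ s : ℝ, 0 < s → s < s0 → ∀ n : ℕ,
      (volume.restrict (Ioo (0:ℝ) 1)) {x | ∃ k < n, circDist ((lsv a)^[k] x) xt < s} ≤
        C * ((n + 1 : ℕ) * ENNReal.ofReal s) := by
  have hmem : ∀ x ∈ Ioo (0:ℝ) 1, ∀ k, (lsv a)^[k] x ∈ Ico (0:ℝ) 1 := fun x hx k =>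
    lsv_iter_mem_Ico ha0 ⟨hx.1.le, hx.2⟩ k
  rcases hxt.1.lt_or_eq with h0 | h0
  · refine ⟨ENNReal.ofReal (1 / (xt / 2)) * 2, by finiteness, min (xt / 2) (1 - xt), ?_, ?_⟩
    · exact lt_min (by linarith) (by linarith [hxt.2])
    intro s hs hs0 n
    have hs1 := lt_of_lt_of_le hs0 (min_le_left _ _)
    have hs2 := lt_of_lt_of_le hs0 (min_le_right _ _)
    have hsub : ∀ x ∈ Ioo (0:ℝ) 1, (∃ k < n, circDist ((lsv a)^[k] x) xt < s) →
        ∃ k < n, (lsv a)^[k] x ∈ Ioo (xt - s) (xt + s) := by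
      rintro x hx ⟨k, hk, hd⟩
      refine ⟨k, hk, ?_⟩
      have hy := hmem x hx k
      unfold circDist at hd
      rcases min_lt_iff.1 hd with h | h
      · rw [abs_lt] at h
        constructor <;> linarith
      · exfalso
        have : 1 - s < |(lsv a)^[k] x - xt| := by linarith
        rcases lt_abs.1 this with h | h <;> linarith [hy.1, hy.2]
    calc (volume.restrict (Ioo (0:ℝ) 1)) {x | ∃ k < n, circDist ((lsv a)^[k] x) xt < s}
        ≤ (volume.restrict (Ioo (0:ℝ) 1)) {x | ∃ k < n, (lsv a)^[k] x ∈ Ioo (xt - s) (xt + s)} := by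
          apply measure_mono_ae
          filter_upwards [ae_restrict_mem measurableSet_Ioo] with x hx h
          exact hsub x hx h
      _ ≤ n * (ENNReal.ofReal (1 / (xt / 2)) * volume (Ioo (xt - s) (xt + s))) :=
          lsv_hit_bound ha0 ha1 measurableSet_Ioo (by linarith)
            (fun y hy => by simp only [mem_Ici]; linarith [hy.1]) n
      _ = ENNReal.ofReal (1 / (xt / 2)) * 2 * (n * ENNReal.ofReal s) := by
          rw [Real.volume_Ioo, show xt + s - (xt - s) = 2 * s by ring,
            ENNReal.ofReal_mul (by norm_num)]
          simp only [ENNReal.ofReal_ofNat]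
          ring
      _ ≤ _ := by gcongr; exact Nat.le_succ n
  · subst h0
    refine ⟨4, by finiteness, 1 / 2, by norm_num, ?_⟩
    intro s hs hs0 n
    set D : Set ℝ := Ioo (1 - s) 1 ∪ Ico (1 / 2) (1 / 2 + s / 2) with hD
    have hDm : MeasurableSet D := measurableSet_Ioo.union measurableSet_Ico
    have hsub : ∀ x ∈ Ioo (0:ℝ) 1, (∃ k < n, circDist ((lsv a)^[k] x) 0 < s) →
        x < s ∨ ∃ k < n, (lsv a)^[k] x ∈ D := by
      intro x hx hk
      by_contra! hcon
      obtain ⟨hxs, hnD⟩ := hcon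
      have key : ∀ k < n, s ≤ (lsv a)^[k] x := by
        intro k
        induction k with
        | zero => intro _; simpa using hxs
        | succ k ih =>
          intro hk
          have h1 := ih (by omega)
          have h2 := hnD k (by omega)
          have h3 := hmem x hx k
          rw [Function.iterate_succ_apply']
          by_cases h : (lsv a)^[k] x < 1 / 2
          · exact h1.trans (lsv_left_ge h3.1 h)
          · rw [lsv_right (not_lt.1 h)]
            have : 1 / 2 + s / 2 ≤ (lsv a)^[k] x := by
              by_contra! hlt
              exact h2 (Or.inr ⟨not_lt.1 h, hlt⟩)
            linarith
      obtain ⟨k, hk, hd⟩ := hk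
      have h1 := key k hk
      have h2 := hnD k hk
      have h3 := hmem x hx k
      unfold circDist at hd
      rw [sub_zero, abs_of_nonneg h3.1] at hd
      rcases min_lt_iff.1 hd with h | h
      · linarith
      · exact h2 (Or.inl ⟨by linarith, h3.2⟩)
    have hvol : volume D ≤ 1 * ENNReal.ofReal s + 1 * ENNReal.ofReal s := by
      refine (measure_union_le _ _).trans ?_
      rw [Real.volume_Ioo, Real.volume_Ico, one_mul]
      exact add_le_add (ENNReal.ofReal_le_ofReal (by linarith))
        (ENNReal.ofReal_le_ofReal (by linarith))
    calc (volume.restrict (Ioo (0:ℝ) 1)) {x | ∃ k < n, circDist ((lsv a)^[k] x) 0 < s}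
        ≤ (volume.restrict (Ioo (0:ℝ) 1)) (Iio s ∪ {x | ∃ k < n, (lsv a)^[k] x ∈ D}) := by
          apply measure_mono_ae
          filter_upwards [ae_restrict_mem measurableSet_Ioo] with x hx h
          exact hsub x hx h
      _ ≤ (volume.restrict (Ioo (0:ℝ) 1)) (Iio s) +
          (volume.restrict (Ioo (0:ℝ) 1)) {x | ∃ k < n, (lsv a)^[k] x ∈ D} := measure_union_le _ _
      _ ≤ ENNReal.ofReal s + n * (ENNReal.ofReal (1 / (1 / 2)) * volume D) := by
          gcongr
          · rw [Measure.restrict_apply measurableSet_Iio]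
            calc volume (Iio s ∩ Ioo 0 1) ≤ volume (Ioo 0 s) :=
                  measure_mono (fun y hy => ⟨hy.2.1, hy.1⟩)
              _ = _ := by simp
          · refine lsv_hit_bound ha0 ha1 hDm (by norm_num) ?_ n
            rintro y (hy | hy)
            · simp only [mem_Ici]; linarith [hy.1]
            · exact hy.1
      _ ≤ 4 * ENNReal.ofReal s + n * (2 * (1 * ENNReal.ofReal s + 1 * ENNReal.ofReal s)) := by
          gcongr
          · exact le_mul_of_one_le_left zero_le (by norm_num)
          · norm_num
      _ = _ := by push_cast; ring

lemma lsv_upper {a xt : ℝ} (ha0 : 0 < a) (ha1 : a < 1) (hxt : xt ∈ Ico (0:ℝ) 1) :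
    ∀ᵐ x ∂(volume.restrict (Ioo (0:ℝ) 1)), ∀ᶠ p : ℕ in atTop, ∀ k < 2 ^ (p + 1),
      1 / (2 ^ p * (p:ℝ) ^ 2) ≤ circDist ((lsv a)^[k] x) xt := by
  obtain ⟨C, hC, s0, hs0, hb⟩ := lsv_near_bound ha0 ha1 hxt
  have hlim : Tendsto (fun p : ℕ => 1 / (2 ^ p * (p:ℝ) ^ 2)) atTop (nhds 0) := by
    apply squeeze_zero (g := fun p : ℕ => (1 / 2 : ℝ) ^ p) (fun p => by positivity)
    · intro p
      rcases Nat.eq_zero_or_pos p with rfl | hp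
      · simp
      · have : (1:ℝ) ≤ p := by exact_mod_cast hp
        rw [one_div_pow]
        apply one_div_le_one_div_of_le (by positivity)
        exact le_mul_of_one_le_right (by positivity) (one_le_pow₀ this)
    · exact tendsto_pow_atTop_nhds_zero_of_lt_one (by norm_num) (by norm_num)
  have hev := hlim.eventually_lt_const hs0
  obtain ⟨p0, hp0⟩ := eventually_atTop.1 hev
  set A : ℕ → Set ℝ := fun p => if p0 ≤ p ∧ 1 ≤ p then
    {x | ∃ k < 2 ^ (p + 1), circDist ((lsv a)^[k] x) xt < 1 / (2 ^ p * (p:ℝ) ^ 2)} else ∅ with hA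
  have hsum : ∑' p, (volume.restrict (Ioo (0:ℝ) 1)) (A p) ≠ ⊤ := by
    have hle : ∀ p, (volume.restrict (Ioo (0:ℝ) 1)) (A p) ≤
        C * ENNReal.ofReal (3 * (1 / (p:ℝ) ^ 2)) := by
      intro p
      simp only [hA]
      split_ifs with hp
      · have hp1 : (0:ℝ) < p := by exact_mod_cast hp.2
        refine (hb _ (by positivity) (hp0 p hp.1) _).trans ?_
        gcongr
        rw [← ENNReal.ofReal_natCast, ← ENNReal.ofReal_mul (by positivity)]
        apply ENNReal.ofReal_le_ofReal
        push_cast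
        have h1 : (1:ℝ) ≤ 2 ^ p := one_le_pow₀ (by norm_num)
        rw [mul_one_div, mul_one_div, div_le_div_iff₀ (by positivity) (by positivity), pow_succ]
        have h2 : (0:ℝ) < (p:ℝ) ^ 2 := by positivity
        nlinarith
      · simp
    refine ne_top_of_le_ne_top ?_ (ENNReal.tsum_le_tsum hle)
    rw [ENNReal.tsum_mul_left]
    apply ENNReal.mul_ne_top hC
    have : Summable fun p : ℕ => 3 * (1 / (p:ℝ) ^ 2) :=
      (Real.summable_one_div_nat_pow.2 (by norm_num)).mul_left 3
    exact this.tsum_ofReal_ne_top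
  filter_upwards [ae_eventually_notMem hsum] with x hx
  filter_upwards [hx, eventually_ge_atTop p0, eventually_ge_atTop 1] with p hp h1 h2
  simp only [hA, if_pos (And.intro h1 h2), mem_ofPred_eq, not_exists, not_and, not_lt] at hp
  exact hp
/-! ### The jump transformation -/

def lsvU (a : ℝ) : ℕ → Set ℝ
  | 0 => Ioo (1 / 2) 1
  | i + 1 => Ioo 0 (1 / 2) ∩ lsv a ⁻¹' lsvU a i

def lsvTau (a : ℝ) (x : ℝ) : ℕ := sInf {k | 1 / 2 ≤ (lsv a)^[k] x}

def lsvG (a : ℝ) (x : ℝ) : ℝ := (lsv a)^[lsvTau a x + 1] x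

def lsvX (a : ℝ) : Set ℝ := {x | ∀ k, (lsv a)^[k] x ∈ Ioo (0:ℝ) 1 ∧ (lsv a)^[k] x ≠ 1 / 2}

def lsvCyl (a : ℝ) : List ℕ → Set ℝ
  | [] => Ioo 0 1
  | i :: w => lsvU a i ∩ lsvG a ⁻¹' lsvCyl a w

lemma lsvU_sub (a : ℝ) (i : ℕ) : lsvU a i ⊆ Ioo 0 1 := by
  cases i with
  | zero => exact Ioo_subset_Ioo (by norm_num) le_rfl
  | succ i => exact fun x hx => ⟨hx.1.1, by linarith [hx.1.2]⟩

lemma lsvU_meas (a : ℝ) (i : ℕ) : MeasurableSet (lsvU a i) := by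
  induction i with
  | zero => exact measurableSet_Ioo
  | succ i ih => exact measurableSet_Ioo.inter (lsv_measurable a ih)

lemma lsvU_spec {a : ℝ} (i : ℕ) : ∀ x ∈ lsvU a i,
    1 / 2 ≤ (lsv a)^[i] x ∧ ∀ j < i, (lsv a)^[j] x < 1 / 2 := by
  induction i with
  | zero => intro x hx; exact ⟨hx.1.le, by simp⟩
  | succ i ih =>
    intro x hx
    have := ih _ hx.2
    refine ⟨this.1, ?_⟩
    intro j hj
    cases j with
    | zero => exact hx.1.2
    | succ j => exact this.2 j (by omega)

lemma lsvTau_eq_iff {a x : ℝ} {i : ℕ} : lsvTau a x = i ↔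
    (1 / 2 ≤ (lsv a)^[i] x ∧ ∀ j < i, (lsv a)^[j] x < 1 / 2) ∨
      (i = 0 ∧ ∀ k, (lsv a)^[k] x < 1 / 2) := by
  unfold lsvTau
  constructor
  · rintro rfl
    by_cases h : ({k | 1 / 2 ≤ (lsv a)^[k] x} : Set ℕ).Nonempty
    · left
      refine ⟨Nat.sInf_mem h, fun j hj => ?_⟩
      have := Nat.notMem_of_lt_sInf hj
      exact not_le.1 this
    · right
      rw [Set.not_nonempty_iff_eq_empty] at h
      refine ⟨by rw [h]; simp, fun k => ?_⟩
      have : k ∉ ({k | 1 / 2 ≤ (lsv a)^[k] x} : Set ℕ) := by rw [h]; simp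
      exact not_le.1 this
  · rintro (⟨h1, h2⟩ | ⟨rfl, h⟩)
    · apply le_antisymm (Nat.sInf_le h1)
      by_contra! hlt
      have := Nat.sInf_mem (s := {k | 1 / 2 ≤ (lsv a)^[k] x}) ⟨i, h1⟩
      exact absurd (h2 _ hlt) (not_lt.2 this)
    · rw [Nat.sInf_eq_zero]
      right
      ext k
      simpa using h k

lemma lsvTau_of_mem {a x : ℝ} {i : ℕ} (hx : x ∈ lsvU a i) : lsvTau a x = i :=
  lsvTau_eq_iff.2 (Or.inl (lsvU_spec i x hx))

lemma lsvTau_measurable (a : ℝ) : Measurable (lsvTau a) := by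
  apply measurable_to_countable'
  intro i
  have hm : ∀ k, Measurable ((lsv a)^[k]) := fun k => (lsv_measurable a).iterate k
  have : lsvTau a ⁻¹' {i} = ({x | 1 / 2 ≤ (lsv a)^[i] x} ∩
      ⋂ j, ⋂ (_ : j < i), {x | (lsv a)^[j] x < 1 / 2}) ∪
      ({_x | i = 0} ∩ ⋂ k, {x | (lsv a)^[k] x < 1 / 2}) := by
    ext x
    simp only [mem_preimage, mem_singleton_iff, mem_union, mem_inter_iff, mem_iInter,
      mem_ofPred_eq]
    exact lsvTau_eq_iff
  rw [this]
  apply MeasurableSet.union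
  · apply MeasurableSet.inter
    · exact measurableSet_le measurable_const (hm i)
    · exact MeasurableSet.iInter fun j => MeasurableSet.iInter fun _ =>
        measurableSet_lt (hm j) measurable_const
  · apply MeasurableSet.inter
    · exact MeasurableSet.const _
    · exact MeasurableSet.iInter fun j => measurableSet_lt (hm j) measurable_const

lemma lsvG_measurable (a : ℝ) : Measurable (lsvG a) := by
  have h : Measurable (fun p : ℕ × ℝ => (lsv a)^[p.1 + 1] p.2) :=
    measurable_from_prod_countable_right fun k => (lsv_measurable a).iterate (k + 1)
  exact h.comp ((lsvTau_measurable a).prodMk measurable_id)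

lemma lsvG_of_mem {a x : ℝ} {i : ℕ} (hx : x ∈ lsvU a i) : lsvG a x = (lsv a)^[i + 1] x := by
  rw [lsvG, lsvTau_of_mem hx]

lemma lsvX_iter {a x : ℝ} (hx : x ∈ lsvX a) (k : ℕ) : (lsv a)^[k] x ∈ lsvX a := by
  intro j
  rw [← Function.iterate_add_apply]
  exact hx _

lemma lsvX_G {a x : ℝ} (hx : x ∈ lsvX a) : lsvG a x ∈ lsvX a := lsvX_iter hx _

lemma lsvX_G_iter {a x : ℝ} (hx : x ∈ lsvX a) (k : ℕ) : (lsvG a)^[k] x ∈ lsvX a := by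
  induction k with
  | zero => exact hx
  | succ k ih => rw [Function.iterate_succ_apply']; exact lsvX_G ih

lemma lsv_V_step {a x : ℝ} (ha0 : 0 < a) (ha1 : a < 1) (hx : x ∈ Ioo (0:ℝ) (1 / 2)) :
    2 / a * (lsv a x) ^ (-a) + 1 ≤ 2 / a * x ^ (-a) := by
  have hx0 := hx.1
  rw [lsv_left hx.2]
  set t := (2:ℝ) ^ a * x ^ a with ht
  have ht0 : 0 < t := by positivity
  have ht1 : t < 1 := lsv_t_lt ha0 hx0.le hx.2
  rw [mul_rpow hx0.le (by positivity)]
  have h1 : (1 + t) ^ (-a) ≤ 1 - a * t / 2 := by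
    have h2 : (1 + t) ^ (-a) = (1 + (-(t / (1 + t)))) ^ a := by
      rw [rpow_neg (by positivity), ← inv_rpow (by positivity)]
      congr 1
      field_simp
      ring
    have h3 : t / (1 + t) ≤ 1 := by rw [div_le_one (by positivity)]; linarith
    have h4 : t / 2 ≤ t / (1 + t) := by
      apply div_le_div_of_nonneg_left ht0.le (by positivity) (by linarith)
    rw [h2]
    refine (rpow_one_add_le_one_add_mul_self (by linarith) ha0.le ha1.le).trans ?_
    nlinarith
  have h5 : x ^ (-a) * t = 2 ^ a := by
    rw [ht, rpow_neg hx0.le]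
    have := (rpow_pos_of_pos hx0 a).ne'
    field_simp
  have h6 : (1:ℝ) ≤ 2 ^ a := one_le_rpow (by norm_num) ha0.le
  have h7 : x ^ (-a) * (1 + t) ^ (-a) ≤ x ^ (-a) * (1 - a * t / 2) := by gcongr
  have h8 : x ^ (-a) * (1 - a * t / 2) = x ^ (-a) - a / 2 * 2 ^ a := by
    rw [← h5]; ring
  have h9 : 2 / a * (x ^ (-a) * (1 + t) ^ (-a)) ≤ 2 / a * (x ^ (-a) - a / 2 * 2 ^ a) := by
    rw [← h8]; gcongr
  have h10 : 2 / a * (x ^ (-a) - a / 2 * 2 ^ a) = 2 / a * x ^ (-a) - 2 ^ a := by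
    field_simp
  linarith

lemma lsvU_le_V {a : ℝ} (ha0 : 0 < a) (ha1 : a < 1) (i : ℕ) : ∀ x ∈ lsvU a i,
    (i:ℝ) ≤ 2 / a * x ^ (-a) := by
  induction i with
  | zero => intro x hx; have := (lsvU_sub a 0 hx).1; simp; positivity
  | succ i ih =>
    intro x hx
    have h1 := ih _ hx.2
    have h2 := lsv_V_step ha0 ha1 hx.1
    push_cast
    linarith

lemma lsvX_mem_U {a : ℝ} (ha0 : 0 < a) (ha1 : a < 1) {x : ℝ} (hx : x ∈ lsvX a) :
    ∃ i, x ∈ lsvU a i := by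
  have key : ∀ N : ℕ, ∀ x ∈ lsvX a, 2 / a * x ^ (-a) ≤ N → ∃ i, x ∈ lsvU a i := by
    intro N
    induction N with
    | zero =>
      intro x hx h
      have := (hx 0).1.1
      simp only [Function.iterate_zero, id] at this
      have h2 : 0 < 2 / a * x ^ (-a) := by positivity
      simp at h
      linarith
    | succ N ih =>
      intro x hx h
      have h0 := hx 0
      simp only [Function.iterate_zero, id] at h0
      rcases lt_or_gt_of_ne h0.2 with h1 | h1
      · have hstep := lsv_V_step ha0 ha1 ⟨h0.1.1, h1⟩
        push_cast at h
        obtain ⟨i, hi⟩ := ih (lsv a x) (lsvX_iter hx 1) (by linarith)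
        exact ⟨i + 1, ⟨h0.1.1, h1⟩, hi⟩
      · exact ⟨0, h1, h0.1.2⟩
  obtain ⟨N, hN⟩ := exists_nat_ge (2 / a * x ^ (-a))
  exact key N x hx hN

lemma lsvX_meas (a : ℝ) : MeasurableSet (lsvX a) := by
  have : lsvX a = ⋂ k, (lsv a)^[k] ⁻¹' (Ioo (0:ℝ) 1 \ {1 / 2}) := by
    ext x; simp only [lsvX, mem_iInter]; rfl
  rw [this]
  exact MeasurableSet.iInter fun k => ((lsv_measurable a).iterate k)
    (measurableSet_Ioo.diff (measurableSet_singleton _))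

lemma lsvX_ae {a : ℝ} (ha0 : 0 < a) (ha1 : a < 1) :
    ∀ᵐ x ∂(volume.restrict (Ioo (0:ℝ) 1)), x ∈ lsvX a := by
  have : ∀ k, ∀ᵐ x ∂(volume.restrict (Ioo (0:ℝ) 1)),
      (lsv a)^[k] x ∈ Ioo (0:ℝ) 1 \ {1 / 2} := by
    intro k
    have hm : MeasurableSet (Ioo (0:ℝ) 1 \ {1 / 2}) :=
      measurableSet_Ioo.diff (measurableSet_singleton _)
    have h := lsvCone_null (lsvCone_iter ha0 ha1 k) hm.compl (by
      apply measure_mono_null (t := {(1 / 2 : ℝ)}) _ (by simp)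
      intro x hx
      by_contra hne
      exact hx.1 ⟨hx.2, hne⟩)
    rw [Measure.map_apply ((lsv_measurable a).iterate k) hm.compl] at h
    exact h
  filter_upwards [ae_all_iff.2 this] with x hx k
  exact ⟨(hx k).1, (hx k).2⟩

lemma lsvX_null {a : ℝ} (ha0 : 0 < a) (ha1 : a < 1) : volume ((lsvX a)ᶜ ∩ Ioo (0:ℝ) 1) = 0 := by
  rw [← Measure.restrict_apply (lsvX_meas a).compl]
  exact lsvX_ae ha0 ha1

lemma lsvU_map {a : ℝ} (ha0 : 0 < a) (ha1 : a < 1) (i : ℕ) : ∀ μ, LsvCone a μ →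
    LsvGood a (Measure.map ((lsv a)^[i + 1]) (μ.restrict (lsvU a i))) := by
  induction i with
  | zero => intro μ h; exact lsvGood_right ha0 ha1 h
  | succ i ih =>
    intro μ h
    have := ih _ (lsvCone_left ha0 h)
    rw [Measure.restrict_map (lsv_measurable a) (lsvU_meas a i),
      Measure.map_map ((lsv_measurable a).iterate _) (lsv_measurable a),
      Measure.restrict_restrict (lsv_measurable a (lsvU_meas a i)), inter_comm] at this
    exact this

lemma lsvG_map_U {a : ℝ} (ha0 : 0 < a) (ha1 : a < 1) (i : ℕ) (μ : Measure ℝ) (h : LsvCone a μ) :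
    LsvGood a (Measure.map (lsvG a) (μ.restrict (lsvU a i))) := by
  have : Measure.map (lsvG a) (μ.restrict (lsvU a i)) =
      Measure.map ((lsv a)^[i + 1]) (μ.restrict (lsvU a i)) := by
    apply Measure.map_congr
    filter_upwards [ae_restrict_mem (lsvU_meas a i)] with x hx
    exact lsvG_of_mem hx
  rw [this]
  exact lsvU_map ha0 ha1 i μ h

lemma lsvCyl_meas (a : ℝ) (w : List ℕ) : MeasurableSet (lsvCyl a w) := by
  induction w with
  | nil => exact measurableSet_Ioo
  | cons i w ih => exact (lsvU_meas a i).inter (lsvG_measurable a ih)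

lemma lsvCyl_map {a : ℝ} (ha0 : 0 < a) (ha1 : a < 1) (w : List ℕ) : ∀ μ, LsvGood a μ →
    LsvGood a (Measure.map ((lsvG a)^[w.length]) (μ.restrict (lsvCyl a w))) := by
  induction w with
  | nil =>
    intro μ h
    have : μ.restrict (Ioo 0 1) = μ := lsvCone_restrict_eq h.1 measurableSet_Ioo (by simp)
    simpa [lsvCyl, this] using h
  | cons i w ih =>
    intro μ h
    have := ih _ (lsvG_map_U ha0 ha1 i μ h.1)
    rw [Measure.restrict_map (lsvG_measurable a) (lsvCyl_meas a w),
      Measure.map_map ((lsvG_measurable a).iterate _) (lsvG_measurable a),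
      Measure.restrict_restrict (lsvG_measurable a (lsvCyl_meas a w)), inter_comm] at this
    exact this

lemma lsvCyl_inj {a : ℝ} (w : List ℕ) : ∀ w' : List ℕ, ∀ x, w.length = w'.length →
    x ∈ lsvCyl a w → x ∈ lsvCyl a w' → w = w' := by
  induction w with
  | nil => intro w' x hl _ _; exact (List.length_eq_zero_iff.1 hl.symm).symm
  | cons i w ih =>
    intro w' x hl h h'
    cases w' with
    | nil => simp at hl
    | cons i' w' =>
      have h1 : i = i' := (lsvTau_of_mem h.1).symm.trans (lsvTau_of_mem h'.1)
      have h2 := ih w' _ (by simpa using hl) h.2 h'.2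
      rw [h1, h2]

lemma lsvX_mem_Cyl {a : ℝ} (ha0 : 0 < a) (ha1 : a < 1) (m : ℕ) : ∀ x ∈ lsvX a,
    ∃ w : List ℕ, w.length = m ∧ x ∈ lsvCyl a w := by
  induction m with
  | zero => intro x hx; exact ⟨[], rfl, (hx 0).1⟩
  | succ m ih =>
    intro x hx
    obtain ⟨i, hi⟩ := lsvX_mem_U ha0 ha1 hx
    obtain ⟨w, hw, hxw⟩ := ih _ (lsvX_G hx)
    exact ⟨i :: w, by simp [hw], hi, hxw⟩

def lsvUnion (a : ℝ) (m : ℕ) (P : List ℕ → Prop) : Set ℝ :=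
  ⋃ w : {w : List ℕ // w.length = m ∧ P w}, lsvCyl a w.1

lemma lsvUnion_meas (a : ℝ) (m : ℕ) (P : List ℕ → Prop) : MeasurableSet (lsvUnion a m P) :=
  MeasurableSet.iUnion fun w => lsvCyl_meas a w.1

lemma lsvUnion_map {a : ℝ} (ha0 : 0 < a) (ha1 : a < 1) (m : ℕ) (P : List ℕ → Prop)
    {μ : Measure ℝ} (h : LsvGood a μ) :
    LsvGood a (Measure.map ((lsvG a)^[m]) (μ.restrict (lsvUnion a m P))) := by
  rw [lsvUnion, Measure.restrict_iUnion, Measure.map_sum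
    ((lsvG_measurable a).iterate m).aemeasurable]
  · apply lsvGood_sum
    rintro ⟨w, rfl, hw⟩
    exact lsvCyl_map ha0 ha1 w μ h
  · intro w w' hne
    apply Set.disjoint_left.2
    intro x hx hx'
    exact hne (Subtype.ext (lsvCyl_inj w.1 w'.1 x (w.2.1.trans w'.2.1.symm) hx hx'))
  · exact fun w => lsvCyl_meas a w.1

lemma lsvG_iter_good {a : ℝ} (ha0 : 0 < a) (ha1 : a < 1) (m : ℕ) :
    LsvGood a (Measure.map ((lsvG a)^[m]) (volume.restrict (Ioo (0:ℝ) 1))) := by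
  have h := lsvUnion_map ha0 ha1 m (fun _ => True) (lsvGood_leb (a := a) ha0)
  rwa [lsvCone_restrict_eq (lsvGood_leb ha0).1 (lsvUnion_meas a m _)] at h
  apply measure_mono_null _ (lsvX_null ha0 ha1)
  apply inter_subset_inter_left
  apply compl_subset_compl.2
  intro x hx
  obtain ⟨w, hw, hxw⟩ := lsvX_mem_Cyl ha0 ha1 m x hx
  exact mem_iUnion.2 ⟨⟨w, hw, trivial⟩, hxw⟩

/-! ### Expansion -/

lemma lsvU_expand {a : ℝ} (ha0 : 0 < a) (i : ℕ) : ∀ x ∈ lsvU a i, ∀ y ∈ lsvU a i,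
    2 * |x - y| ≤ |(lsv a)^[i + 1] x - (lsv a)^[i + 1] y| := by
  induction i with
  | zero =>
    intro x hx y hy
    simp only [zero_add, Function.iterate_one]
    rw [lsv_right hx.1.le, lsv_right hy.1.le, show 2 * x - 1 - (2 * y - 1) = 2 * (x - y) by ring,
      abs_mul, abs_two]
  | succ i ih =>
    intro x hx y hy
    have h1 := ih _ hx.2 _ hy.2
    have h2 : |x - y| ≤ |lsv a x - lsv a y| := by
      rcases le_total x y with h | h
      · have := lsv_left_expand ha0 hx.1 hy.1 h
        rw [abs_sub_comm, abs_sub_comm (lsv a x)]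
        rw [abs_of_nonneg (by linarith), abs_of_nonneg (by linarith)]
        exact this
      · have := lsv_left_expand ha0 hy.1 hx.1 h
        rw [abs_of_nonneg (by linarith), abs_of_nonneg (by linarith)]
        exact this
    rw [Function.iterate_succ_apply, Function.iterate_succ_apply _ _ y]
    linarith

lemma lsvCyl_diam {a : ℝ} (ha0 : 0 < a) (w : List ℕ) : ∀ x ∈ lsvCyl a w, ∀ y ∈ lsvCyl a w,
    2 ^ w.length * |x - y| ≤ 1 := by
  induction w with
  | nil =>
    intro x hx y hy
    have := hx.1
    have := hx.2
    have := hy.1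
    have := hy.2
    simp only [List.length_nil, pow_zero, one_mul]
    rw [abs_le]; constructor <;> linarith
  | cons i w ih =>
    intro x hx y hy
    have h1 := ih _ hx.2 _ hy.2
    have h2 := lsvU_expand ha0 i x hx.1 y hy.1
    rw [lsvG_of_mem hx.1, lsvG_of_mem hy.1] at h1
    have h3 : (0:ℝ) < 2 ^ w.length := by positivity
    rw [List.length_cons, pow_succ]
    nlinarith

/-! ### Avoidance estimate -/

lemma lsv_avoid {a b r : ℝ} (ha0 : 0 < a) (ha1 : a < 1) (hb : 0 ≤ b) (hr : 0 < r)
    (hbr : b + r ≤ 1) (m : ℕ) (hm : 1 ≤ 2 ^ m * (r / 4)) (N : ℕ) : ∀ μ, LsvGood a μ →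
    μ univ ≠ ⊤ →
    μ {x | ∀ j < N, (lsvG a)^[j * m] x ∈ lsvUnion a m (fun w => ¬ lsvCyl a w ⊆ Ioo b (b + r))} ≤
      ENNReal.ofReal ((1 - r / 8) ^ N) * μ univ := by
  set A := lsvUnion a m (fun w => ¬ lsvCyl a w ⊆ Ioo b (b + r)) with hA
  have hr1 : r ≤ 1 := by linarith
  have hAmeas : MeasurableSet A := lsvUnion_meas a m _
  have hdis : A ⊆ (Ioo (b + r / 4) (b + 3 * r / 4))ᶜ := by
    intro x hx hx'
    obtain ⟨⟨w, hw, hnot⟩, hxw⟩ := mem_iUnion.1 hx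
    apply hnot
    intro y hy
    have h1 := lsvCyl_diam ha0 w x hxw y hy
    rw [hw] at h1
    have h2 : |x - y| ≤ r / 4 := by
      have h3 : (0:ℝ) < 2 ^ m := by positivity
      exact le_of_mul_le_mul_left (h1.trans hm) h3
    rw [abs_le] at h2
    constructor <;> linarith [hx'.1, hx'.2, h2.1, h2.2]
  have hone : ∀ μ, LsvGood a μ → μ univ ≠ ⊤ → μ A ≤ ENNReal.ofReal (1 - r / 8) * μ univ := by
    intro μ h hfin
    have h1 := (h.2 (Ioo (b + r / 4) (b + 3 * r / 4)) measurableSet_Ioo).2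
    rw [inter_eq_left.2 (Ioo_subset_Ioo (by linarith) (by linarith)), Real.volume_Ioo,
      show b + 3 * r / 4 - (b + r / 4) = r / 2 by ring] at h1
    have h2 : μ A + μ (Ioo (b + r / 4) (b + 3 * r / 4)) ≤ μ univ := by
      rw [← measure_union (disjoint_left.2 fun x hx hx' => hdis hx hx') measurableSet_Ioo]
      exact measure_mono (subset_univ _)
    have hfin2 : μ A ≠ ⊤ := ne_top_of_le_ne_top hfin (measure_mono (subset_univ _))
    have hfin3 : μ (Ioo (b + r / 4) (b + 3 * r / 4)) ≠ ⊤ :=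
      ne_top_of_le_ne_top hfin (measure_mono (subset_univ _))
    obtain ⟨M, hM, eM⟩ : ∃ M : ℝ, 0 ≤ M ∧ μ univ = ENNReal.ofReal M :=
      ⟨_, ENNReal.toReal_nonneg, (ENNReal.ofReal_toReal hfin).symm⟩
    obtain ⟨MA, hMA, eA⟩ : ∃ M : ℝ, 0 ≤ M ∧ μ A = ENNReal.ofReal M :=
      ⟨_, ENNReal.toReal_nonneg, (ENNReal.ofReal_toReal hfin2).symm⟩
    obtain ⟨MB, hMB, eB⟩ : ∃ M : ℝ, 0 ≤ M ∧
        μ (Ioo (b + r / 4) (b + 3 * r / 4)) = ENNReal.ofReal M :=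
      ⟨_, ENNReal.toReal_nonneg, (ENNReal.ofReal_toReal hfin3).symm⟩
    rw [eM, eB] at h1
    rw [eM, eA, eB] at h2
    rw [eM, eA]
    rw [← ENNReal.ofReal_mul hM, show (4 : ℝ≥0∞) = ENNReal.ofReal 4 by norm_num,
      ← ENNReal.ofReal_mul (by norm_num), ENNReal.ofReal_le_ofReal_iff (by positivity)] at h1
    rw [← ENNReal.ofReal_add hMA hMB, ENNReal.ofReal_le_ofReal_iff hM] at h2
    rw [← ENNReal.ofReal_mul (by linarith)]
    apply ENNReal.ofReal_le_ofReal
    linarith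
  induction N with
  | zero => intro μ _ _; simp
  | succ N ih =>
    intro μ h hfin
    have hGm := (lsvG_measurable a).iterate m
    set ν := Measure.map ((lsvG a)^[m]) (μ.restrict A) with hν
    have hg : LsvGood a ν := lsvUnion_map ha0 ha1 m _ h
    have hνu : ν univ = μ A := by
      rw [hν, Measure.map_apply hGm MeasurableSet.univ]; simp
    have hfin2 : ν univ ≠ ⊤ := by
      rw [hνu]; exact ne_top_of_le_ne_top hfin (measure_mono (subset_univ _))
    have hm1 : MeasurableSet {x | ∀ j < N, (lsvG a)^[j * m] x ∈ A} := by
      have : {x | ∀ j < N, (lsvG a)^[j * m] x ∈ A} =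
          ⋂ j, ⋂ (_ : j < N), (lsvG a)^[j * m] ⁻¹' A := by
        ext x; simp
      rw [this]
      exact MeasurableSet.iInter fun j => MeasurableSet.iInter fun _ =>
        (lsvG_measurable a).iterate _ hAmeas
    have h1 : {x | ∀ j < N + 1, (lsvG a)^[j * m] x ∈ A} ⊆
        (lsvG a)^[m] ⁻¹' {x | ∀ j < N, (lsvG a)^[j * m] x ∈ A} ∩ A := by
      intro x hx
      refine ⟨fun j hj => ?_, by simpa using hx 0 (by omega)⟩
      rw [← Function.iterate_add_apply]
      have := hx (j + 1) (by omega)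
      rwa [add_mul, one_mul] at this
    calc μ {x | ∀ j < N + 1, (lsvG a)^[j * m] x ∈ A}
        ≤ μ ((lsvG a)^[m] ⁻¹' {x | ∀ j < N, (lsvG a)^[j * m] x ∈ A} ∩ A) := measure_mono h1
      _ = ν {x | ∀ j < N, (lsvG a)^[j * m] x ∈ A} := by
          rw [hν, Measure.map_apply hGm hm1, Measure.restrict_apply (hGm hm1)]
      _ ≤ ENNReal.ofReal ((1 - r / 8) ^ N) * ν univ := ih ν hg hfin2
      _ ≤ ENNReal.ofReal ((1 - r / 8) ^ N) * (ENNReal.ofReal (1 - r / 8) * μ univ) := by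
          rw [hνu]; gcongr; exact hone μ h hfin
      _ = _ := by
          rw [← mul_assoc, ← ENNReal.ofReal_mul (pow_nonneg (by linarith) _), pow_succ]
/-! ### Time spent -/

def lsvT (a : ℝ) (J : ℕ) (x : ℝ) : ℕ := ∑ i ∈ Finset.range J, (lsvTau a ((lsvG a)^[i] x) + 1)

lemma lsvT_spec (a x : ℝ) (J : ℕ) : (lsvG a)^[J] x = (lsv a)^[lsvT a J x] x := by
  induction J with
  | zero => simp [lsvT]
  | succ J ih =>
    rw [Function.iterate_succ_apply', lsvG]
    unfold lsvT at ih ⊢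
    rw [Finset.sum_range_succ, Nat.add_comm (∑ i ∈ Finset.range J, (lsvTau a ((lsvG a)^[i] x) + 1)) _]
    exact (congrArg _ ih).trans (Function.iterate_add_apply (lsv a) _ _ x).symm

lemma lsvT_mono (a x : ℝ) : Monotone (fun J => lsvT a J x) := by
  intro J J' h
  exact Finset.sum_le_sum_of_subset (Finset.range_mono h)

def lsvE (a : ℝ) : ℝ≥0∞ := ∫⁻ x in Ioo (0:ℝ) 1, ((lsvTau a x + 1 : ℕ) : ℝ≥0∞)

lemma lsvE_fin {a : ℝ} (ha0 : 0 < a) (ha1 : a < 1) : lsvE a ≠ ⊤ := by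
  have hIntg : IntegrableOn (fun x : ℝ => 2 / a * x ^ (-a) + 1) (Ioo 0 1) := by
    apply Integrable.add
    · exact ((intervalIntegral.integrableOn_Ioo_rpow_iff one_pos).2 (by linarith)).const_mul _
    · exact integrableOn_const (by simp)
  have hle : lsvE a ≤ ∫⁻ x in Ioo (0:ℝ) 1, ENNReal.ofReal (2 / a * x ^ (-a) + 1) := by
    apply lintegral_mono_ae
    filter_upwards [lsvX_ae ha0 ha1] with x hx
    obtain ⟨i, hi⟩ := lsvX_mem_U ha0 ha1 hx
    rw [lsvTau_of_mem hi, ← ENNReal.ofReal_natCast]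
    apply ENNReal.ofReal_le_ofReal
    push_cast
    linarith [lsvU_le_V ha0 ha1 i x hi]
  exact ne_top_of_le_ne_top hIntg.lintegral_lt_top.ne hle

lemma lsvTauENN_meas (a : ℝ) : Measurable (fun x => ((lsvTau a x + 1 : ℕ) : ℝ≥0∞)) :=
  (measurable_of_countable (fun n : ℕ => ((n + 1 : ℕ) : ℝ≥0∞))).comp (lsvTau_measurable a)

lemma lsvT_meas (a : ℝ) (J : ℕ) : Measurable (fun x => ((lsvT a J x : ℕ) : ℝ≥0∞)) := by
  simp only [lsvT, Nat.cast_sum]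
  exact Finset.measurable_fun_sum _ fun i _ => (lsvTauENN_meas a).comp ((lsvG_measurable a).iterate i)

lemma lsvT_int {a : ℝ} (ha0 : 0 < a) (ha1 : a < 1) (J : ℕ) :
    ∫⁻ x in Ioo (0:ℝ) 1, ((lsvT a J x : ℕ) : ℝ≥0∞) ≤ J * (4 * lsvE a) := by
  simp only [lsvT, Nat.cast_sum]
  have hm : ∀ i, Measurable (fun x => ((lsvTau a ((lsvG a)^[i] x) + 1 : ℕ) : ℝ≥0∞)) :=
    fun i => (lsvTauENN_meas a).comp ((lsvG_measurable a).iterate i)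
  rw [lintegral_finsetSum _ fun i _ => hm i]
  have h : ∀ i ∈ Finset.range J, ∫⁻ x in Ioo (0:ℝ) 1,
      ((lsvTau a ((lsvG a)^[i] x) + 1 : ℕ) : ℝ≥0∞) ≤ 4 * lsvE a := by
    intro i _
    rw [← lintegral_map (f := fun x => ((lsvTau a x + 1 : ℕ) : ℝ≥0∞)) (lsvTauENN_meas a)
      ((lsvG_measurable a).iterate i)]
    have hle : Measure.map ((lsvG a)^[i]) (volume.restrict (Ioo (0:ℝ) 1)) ≤
        (4 : ℝ≥0∞) • volume.restrict (Ioo (0:ℝ) 1) := by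
      apply Measure.le_iff.2
      intro s hs
      have h1 := ((lsvG_iter_good ha0 ha1 i).2 s hs).1
      have h2 : (Measure.map ((lsvG a)^[i]) (volume.restrict (Ioo (0:ℝ) 1))) univ = 1 := by
        rw [Measure.map_apply ((lsvG_measurable a).iterate i) MeasurableSet.univ]
        simp
      rw [h2, mul_one] at h1
      simpa [Measure.restrict_apply hs] using h1
    refine (lintegral_mono' hle le_rfl).trans ?_
    rw [lintegral_smul_measure]
    rfl
  refine (Finset.sum_le_sum h).trans ?_
  simp

lemma lsvT_markov {a : ℝ} (ha0 : 0 < a) (ha1 : a < 1) (J n : ℕ) (hn : 0 < n) :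
    (volume.restrict (Ioo (0:ℝ) 1)) {x | n ≤ lsvT a J x} ≤
      4 * lsvE a * ENNReal.ofReal ((J : ℝ) / n) := by
  have h1 := meas_ge_le_lintegral_div (μ := volume.restrict (Ioo (0:ℝ) 1))
    (lsvT_meas a J).aemeasurable (ε := (n : ℝ≥0∞)) (by simp; omega) (by simp)
  have h2 : {x | n ≤ lsvT a J x} = {x | (n : ℝ≥0∞) ≤ (lsvT a J x : ℝ≥0∞)} := by
    ext x; simp
  rw [h2]
  refine h1.trans ?_
  rw [ENNReal.ofReal_div_of_pos (by exact_mod_cast hn), ENNReal.ofReal_natCast,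
    ENNReal.ofReal_natCast, ← mul_div_assoc]
  apply ENNReal.div_le_div_right
  rw [mul_comm]
  exact lsvT_int ha0 ha1 J

lemma lsv_lower {a xt : ℝ} (ha0 : 0 < a) (ha1 : a < 1) (hxt : xt ∈ Ico (0:ℝ) 1) :
    ∀ᵐ x ∂(volume.restrict (Ioo (0:ℝ) 1)), ∀ᶠ p : ℕ in atTop, ∃ k < 2 ^ p,
      circDist ((lsv a)^[k] x) xt ≤ (p:ℝ) ^ 4 / 2 ^ p := by
  have hlim : Tendsto (fun p : ℕ => (p:ℝ) ^ 4 / 2 ^ p) atTop (nhds 0) :=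
    tendsto_pow_const_div_const_pow_of_one_lt 4 (by norm_num)
  have hev := hlim.eventually_lt_const (sub_pos.2 hxt.2)
  obtain ⟨p0, hp0⟩ := eventually_atTop.1 hev
  set r : ℕ → ℝ := fun p => (p:ℝ) ^ 4 / 2 ^ p with hr
  set A : ℕ → Set ℝ := fun p =>
    lsvUnion a p (fun w => ¬ lsvCyl a w ⊆ Ioo xt (xt + r p)) with hA
  set N : ℕ → ℕ := fun p => 2 ^ p / p ^ 3 with hN
  set B1 : ℕ → Set ℝ := fun p => if p0 ≤ p ∧ 2 ≤ p then
    {x | ∀ j < N p, (lsvG a)^[j * p] x ∈ A p} else ∅ with hB1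
  set B2 : ℕ → Set ℝ := fun p => if p0 ≤ p ∧ 2 ≤ p then
    {x | 2 ^ p ≤ lsvT a (N p * p) x} else ∅ with hB2
  have hs1 : ∑' p, (volume.restrict (Ioo (0:ℝ) 1)) (B1 p) ≠ ⊤ := by
    have hle : ∀ p, (volume.restrict (Ioo (0:ℝ) 1)) (B1 p) ≤
        ENNReal.ofReal (exp (1 / 8) * exp (-(1 / 8)) ^ p) := by
      intro p
      simp only [hB1]
      split_ifs with hp
      · have hp2 : (2:ℝ) ≤ p := by exact_mod_cast hp.2
        have hr0 : 0 < r p := by simp only [hr]; positivity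
        have hr1 : r p < 1 - xt := hp0 p hp.1
        have hm : 1 ≤ 2 ^ p * (r p / 4) := by
          have : 2 ^ p * (r p / 4) = (p:ℝ) ^ 4 / 4 := by simp only [hr]; field_simp
          rw [this]
          have : (2:ℝ) ^ 4 ≤ (p:ℝ) ^ 4 := by gcongr
          linarith
        have := lsv_avoid ha0 ha1 hxt.1 hr0 (by linarith) p hm (N p) _ (lsvGood_leb ha0) (by simp)
        refine this.trans ?_
        simp only [Measure.restrict_apply MeasurableSet.univ, univ_inter, Real.volume_Ioo, sub_zero,
          ENNReal.ofReal_one, mul_one]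
        apply ENNReal.ofReal_le_ofReal
        have h1 : 1 - r p / 8 ≤ exp (-(r p / 8)) := by
          have := add_one_le_exp (-(r p / 8)); linarith
        have hx0 := hxt.1
        calc (1 - r p / 8) ^ N p ≤ exp (-(r p / 8)) ^ N p := pow_le_pow_left₀ (by linarith) h1 _
          _ = exp (N p * (-(r p / 8))) := by rw [← exp_nat_mul]
          _ ≤ exp (1 / 8 + p * (-(1 / 8))) := by
              apply exp_le_exp.2
              have h2 : (2:ℝ) ^ p / (p:ℝ) ^ 3 < N p + 1 := by
                have h3 : 2 ^ p < p ^ 3 * (N p + 1) :=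
                  Nat.lt_mul_div_succ _ (pow_pos (by omega : 0 < p) 3)
                rw [div_lt_iff₀ (by positivity), mul_comm]
                exact_mod_cast h3
              have h4 : r p * ((2:ℝ) ^ p / (p:ℝ) ^ 3) = p := by
                simp only [hr]; field_simp
              have h5 : (p:ℝ) ≤ r p * (N p + 1) := by
                rw [← h4]; gcongr
              nlinarith
          _ = _ := by rw [exp_add, exp_nat_mul]
      · simp
    refine ne_top_of_le_ne_top ?_ (ENNReal.tsum_le_tsum hle)
    have : Summable fun p : ℕ => exp (1 / 8) * exp (-(1 / 8)) ^ p :=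
      (summable_geometric_of_lt_one (exp_pos _).le (by rw [exp_lt_one_iff]; norm_num)).mul_left _
    exact this.tsum_ofReal_ne_top
  have hs2 : ∑' p, (volume.restrict (Ioo (0:ℝ) 1)) (B2 p) ≠ ⊤ := by
    have hle : ∀ p, (volume.restrict (Ioo (0:ℝ) 1)) (B2 p) ≤
        4 * lsvE a * ENNReal.ofReal (1 / (p:ℝ) ^ 2) := by
      intro p
      simp only [hB2]
      split_ifs with hp
      · have hp2 : (2:ℝ) ≤ p := by exact_mod_cast hp.2
        refine (lsvT_markov ha0 ha1 _ _ (by positivity)).trans ?_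
        refine mul_le_mul' le_rfl (ENNReal.ofReal_le_ofReal ?_)
        have h1 : (N p : ℝ) * (p:ℝ) ^ 3 ≤ 2 ^ p := by
          exact_mod_cast Nat.div_mul_le_self (2 ^ p) (p ^ 3)
        push_cast
        rw [div_le_div_iff₀ (by positivity) (by positivity)]
        have h2 : (N p : ℝ) * p * (p:ℝ) ^ 2 = N p * (p:ℝ) ^ 3 := by ring
        linarith
      · simp
    refine ne_top_of_le_ne_top ?_ (ENNReal.tsum_le_tsum hle)
    rw [ENNReal.tsum_mul_left]
    apply ENNReal.mul_ne_top (ENNReal.mul_ne_top (by norm_num) (lsvE_fin ha0 ha1))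
    exact (Real.summable_one_div_nat_pow.2 (by norm_num)).tsum_ofReal_ne_top
  filter_upwards [ae_eventually_notMem hs1, ae_eventually_notMem hs2, lsvX_ae ha0 ha1]
    with x h1 h2 hx
  filter_upwards [h1, h2, eventually_ge_atTop p0, eventually_ge_atTop 2] with p hp1 hp2 h3 h4
  simp only [hB1, if_pos (And.intro h3 h4), mem_ofPred_eq, not_forall] at hp1
  simp only [hB2, if_pos (And.intro h3 h4), mem_ofPred_eq, not_le] at hp2
  obtain ⟨j, hj, hnA⟩ := hp1
  refine ⟨lsvT a (j * p) x, ?_, ?_⟩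
  · exact lt_of_le_of_lt (lsvT_mono a x (Nat.mul_le_mul_right p hj.le)) hp2
  · rw [← lsvT_spec]
    obtain ⟨w, hw, hmem⟩ := lsvX_mem_Cyl ha0 ha1 p _ (lsvX_G_iter hx (j * p))
    have hsub : lsvCyl a w ⊆ Ioo xt (xt + r p) := by
      by_contra hcon
      exact hnA (mem_iUnion.2 ⟨⟨w, hw, hcon⟩, hmem⟩)
    have hin := hsub hmem
    refine (min_le_left _ _).trans ?_
    rw [abs_of_pos (by linarith [hin.1])]
    linarith [hin.2]

lemma lsv_log_aux (c : ℕ) (ε K : ℝ) (hε : 0 < ε) :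
    ∀ᶠ p : ℕ in atTop, K * (p:ℝ) ^ c ≤ (p * Real.log 2) ^ ((c:ℝ) + ε) := by
  have hl : 0 < Real.log 2 := Real.log_pos (by norm_num)
  have h1 : Tendsto (fun p : ℕ => (p:ℝ) ^ ε * Real.log 2 ^ ((c:ℝ) + ε)) atTop atTop :=
    ((tendsto_rpow_atTop hε).comp tendsto_natCast_atTop_atTop).atTop_mul_const (by positivity)
  filter_upwards [h1.eventually_ge_atTop K, eventually_ge_atTop 1] with p hp hp1
  have hp0 : (0:ℝ) < p := by exact_mod_cast hp1
  rw [mul_rpow hp0.le hl.le, rpow_add hp0, rpow_natCast]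
  have : 0 < (p:ℝ) ^ c := by positivity
  nlinarith

lemma circDist_nonneg' {x y : ℝ} (hx : x ∈ Ico (0:ℝ) 1) (hy : y ∈ Ico (0:ℝ) 1) :
    0 ≤ circDist x y := by
  apply le_min (abs_nonneg _)
  have : |x - y| ≤ 1 := by
    rw [abs_le]; constructor <;> linarith [hx.1, hx.2, hy.1, hy.2]
  linarith

/-- Corollary: almost sure growth of maxima of `φ(x) = ψ(d(x,x̃))` for the
intermittent map with `0 < α < 1` (finite measure case). -/
theorem lsv_maxima_growth_finite_measure
    (a : ℝ) (ha0 : 0 < a) (ha1 : a < 1)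
    (ψ : ℝ → ℝ) (hψdec : AntitoneOn ψ (Set.Ici 0))
    (xt : ℝ) (hxt : xt ∈ Set.Ico (0 : ℝ) 1) :
    ∀ ε : ℝ, 0 < ε →
      ∀ᵐ x ∂(volume.restrict (Set.Ico (0 : ℝ) 1)), ∀ᶠ n : ℕ in atTop,
        ψ (Real.log n ^ (4 + ε) / (n : ℝ))
            ≤ maxProc (lsv a) (fun y => ψ (circDist y xt)) n x ∧
        maxProc (lsv a) (fun y => ψ (circDist y xt)) n x
            ≤ ψ (1 / ((n : ℝ) * Real.log n ^ (2 + ε))) := by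
  intro ε hε
  rw [← Measure.restrict_congr_set Ioo_ae_eq_Ico]
  filter_upwards [lsv_upper ha0 ha1 hxt, lsv_lower ha0 ha1 hxt, ae_restrict_mem measurableSet_Ioo]
    with x hup hlo hx
  have hlog : Tendsto (fun n : ℕ => Nat.log 2 n) atTop atTop :=
    tendsto_atTop.2 fun b => by
      filter_upwards [eventually_ge_atTop (2 ^ b)] with n hn
      exact Nat.le_log_of_pow_le (by norm_num) hn
  have hmem : ∀ k, (lsv a)^[k] x ∈ Ico (0:ℝ) 1 :=
    fun k => lsv_iter_mem_Ico ha0 ⟨hx.1.le, hx.2⟩ k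
  filter_upwards [hlog.eventually hup, hlog.eventually hlo,
    hlog.eventually (lsv_log_aux 4 ε 2 hε), hlog.eventually (lsv_log_aux 2 ε 1 hε),
    hlog.eventually (eventually_ge_atTop 1), eventually_ge_atTop 1] with n h1 h2 h3 h4 h5 hn
  set p := Nat.log 2 n with hp
  have hn1 : 2 ^ p ≤ n := Nat.pow_log_le_self 2 (by omega)
  have hn2 : n < 2 ^ (p + 1) := Nat.lt_pow_succ_log_self (by norm_num) n
  have hn1' : (2:ℝ) ^ p ≤ n := by exact_mod_cast hn1
  have hn2' : (n:ℝ) < 2 ^ p * 2 := by rw [← pow_succ]; exact_mod_cast hn2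
  have hp0 : (0:ℝ) < p := by exact_mod_cast h5
  have hn0 : (0:ℝ) < n := by exact_mod_cast hn
  have hl : 0 < Real.log 2 := Real.log_pos (by norm_num)
  have hlogn : p * Real.log 2 ≤ Real.log n := by
    rw [← Real.log_pow]; exact Real.log_le_log (by positivity) hn1'
  have hlogn0 : 0 < Real.log n := lt_of_lt_of_le (by positivity) hlogn
  push_cast at h3 h4
  have h3' : 2 * (p:ℝ) ^ 4 ≤ Real.log n ^ (4 + ε) :=
    h3.trans (rpow_le_rpow (by positivity) hlogn (by linarith))
  have h4' : 1 * (p:ℝ) ^ 2 ≤ Real.log n ^ (2 + ε) :=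
    h4.trans (rpow_le_rpow (by positivity) hlogn (by linarith))
  constructor
  · obtain ⟨k, hk, hd⟩ := h2
    have hb : BddAbove (Set.range fun k : Fin n => ψ (circDist ((lsv a)^[k] x) xt)) :=
      (Set.finite_range _).bddAbove
    refine le_trans ?_ (le_ciSup hb ⟨k, lt_of_lt_of_le hk hn1⟩)
    refine hψdec (circDist_nonneg' (hmem k) hxt) (by simp only [Set.mem_Ici]; positivity) ?_
    refine hd.trans ?_
    rw [div_le_div_iff₀ (by positivity) hn0]
    have : 0 < (p:ℝ) ^ 4 := by positivity
    have h2p : (0:ℝ) < 2 ^ p := by positivity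
    nlinarith
  · have : Nonempty (Fin n) := ⟨⟨0, hn⟩⟩
    refine ciSup_le fun k => ?_
    refine hψdec (by simp only [Set.mem_Ici]; positivity) (circDist_nonneg' (hmem k) hxt) ?_
    refine le_trans ?_ (h1 k (k.2.trans hn2))
    apply one_div_le_one_div_of_le (by positivity)
    rw [one_mul] at h4'
    gcongr
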